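/- arXiv:math/0703756 — 8 statements merged into one kernel-verified Lean document; each statement's English description precedes it below -/
import Mathlib

section
/- Let V be a real vector space of dimension 2m (m ≥ 1), and let W be a complex subspace of the complexification V_ℂ = V ⊗_ℝ ℂ such that V_ℂ is the internal direct sum of W and σ(W), where σ is the conjugation of V_ℂ. Then there exists a unique ℝ-linear map J : V → V with J ∘ J = −id such that W equals the ℂ-linear span in V_ℂ of {v ⊗ 1 + (J v) ⊗ i : v ∈ V}. -/
open scoped TensorProduct

namespace Complexification

variable {V : Type*} [AddCommGroup V] [Module ℝ V]

/-- The real part of an element of the complexification. -/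
noncomputable def re : (ℂ ⊗[ℝ] V) →ₗ[ℝ] V :=
  (TensorProduct.lid ℝ V).toLinearMap ∘ₗ LinearMap.rTensor V Complex.reLm

/-- The imaginary part of an element of the complexification. -/
noncomputable def im : (ℂ ⊗[ℝ] V) →ₗ[ℝ] V :=
  (TensorProduct.lid ℝ V).toLinearMap ∘ₗ LinearMap.rTensor V Complex.imLm

@[simp]
theorem re_tmul (c : ℂ) (v : V) : re (c ⊗ₜ[ℝ] v) = c.re • v := by
  simp [re]

@[simp]
theorem im_tmul (c : ℂ) (v : V) : im (c ⊗ₜ[ℝ] v) = c.im • v := by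
  simp [im]

theorem re_add_im (z : ℂ ⊗[ℝ] V) :
    (1 : ℂ) ⊗ₜ[ℝ] re z + Complex.I ⊗ₜ[ℝ] im z = z := by
  induction z with
  | zero => simp
  | tmul c v =>
    rw [re_tmul, im_tmul, ← TensorProduct.smul_tmul, ← TensorProduct.smul_tmul,
      ← TensorProduct.add_tmul]
    congr 1
    apply Complex.ext <;> simp
  | add x y hx hy =>
    rw [map_add, map_add, TensorProduct.tmul_add, TensorProduct.tmul_add]
    nth_rewrite 3 [← hx]
    nth_rewrite 3 [← hy]
    abel

theorem conj_eq (z : ℂ ⊗[ℝ] V) :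
    LinearMap.rTensor V Complex.conjAe.toLinearMap z =
      (1 : ℂ) ⊗ₜ[ℝ] re z - Complex.I ⊗ₜ[ℝ] im z := by
  nth_rewrite 1 [← re_add_im z]
  simp [TensorProduct.neg_tmul, sub_eq_add_neg]

theorem I_smul_eq (z : ℂ ⊗[ℝ] V) :
    Complex.I • z = (1 : ℂ) ⊗ₜ[ℝ] (-im z) + Complex.I ⊗ₜ[ℝ] re z := by
  nth_rewrite 1 [← re_add_im z]
  simp [TensorProduct.smul_tmul', TensorProduct.neg_tmul, TensorProduct.tmul_neg, add_comm]

@[simp]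
theorem re_I_smul (z : ℂ ⊗[ℝ] V) : re (Complex.I • z) = -im z := by
  simp [I_smul_eq]

@[simp]
theorem im_I_smul (z : ℂ ⊗[ℝ] V) : im (Complex.I • z) = re z := by
  simp [I_smul_eq]

/-- If a real subspace is complementary to its conjugate, then taking real parts is a bijection
from it onto the real space. -/
theorem re_bijective_of_isCompl (W : Submodule ℝ (ℂ ⊗[ℝ] V))
    (hW : IsCompl W (W.map (LinearMap.rTensor V Complex.conjAe.toLinearMap))) :
    Function.Bijective (re ∘ₗ W.subtype) := by
  constructor
  · rw [← LinearMap.ker_eq_bot, LinearMap.ker_eq_bot']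
    rintro ⟨w, hw⟩ h
    replace h : re w = 0 := h
    have hconj : LinearMap.rTensor V Complex.conjAe.toLinearMap w = -w := by
      have hre := re_add_im w
      rw [h, TensorProduct.tmul_zero, zero_add] at hre
      rw [conj_eq, h, TensorProduct.tmul_zero, zero_sub, hre]
    have hmem : w ∈ W.map (LinearMap.rTensor V Complex.conjAe.toLinearMap) :=
      ⟨-w, W.neg_mem hw, by rw [map_neg, hconj, neg_neg]⟩
    exact Subtype.ext (Submodule.disjoint_def.1 hW.disjoint w hw hmem)
  · intro v
    obtain ⟨w, hw, _, ⟨w', hw', rfl⟩, h⟩ := Submodule.mem_sup.1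
      (hW.sup_eq_top ▸ Submodule.mem_top : (1 : ℂ) ⊗ₜ[ℝ] v ∈ W ⊔ W.map _)
    refine ⟨⟨w + w', W.add_mem hw hw'⟩, ?_⟩
    have hre := congrArg re h
    rw [map_add, conj_eq] at hre
    simpa using hre

end Complexification

open Complexification

/-- Let `V` be a real vector space of dimension `2m` (`m ≥ 1`), and let `W` be
a complex subspace of the complexification `V_ℂ = ℂ ⊗[ℝ] V` such that `V_ℂ` is the internal
direct sum of `W` and `σ(W)`, where `σ` is the conjugation of `V_ℂ`.  Then there is a unique
`ℝ`-linear map `J : V → V` with `J ∘ J = -id` such that `W` is the `ℂ`-span of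
`{v ⊗ 1 + (J v) ⊗ i : v ∈ V}`. -/
theorem stmt0 (V : Type) [AddCommGroup V] [Module ℝ V] [FiniteDimensional ℝ V]
    (m : ℕ) (hm : 1 ≤ m) (hdim : Module.finrank ℝ V = 2 * m)
    (σ : (ℂ ⊗[ℝ] V) →ₗ[ℝ] (ℂ ⊗[ℝ] V))
    (hσ : σ = LinearMap.rTensor V Complex.conjAe.toLinearMap)
    (W : Submodule ℂ (ℂ ⊗[ℝ] V))
    (hW : IsCompl (W.restrictScalars ℝ) ((W.restrictScalars ℝ).map σ)) :
    ∃! J : V →ₗ[ℝ] V, J ∘ₗ J = -LinearMap.id ∧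
      W = Submodule.span ℂ
        (Set.range fun v : V => (1 : ℂ) ⊗ₜ[ℝ] v + Complex.I ⊗ₜ[ℝ] (J v)) := by
  subst hσ
  let e := LinearEquiv.ofBijective _ (re_bijective_of_isCompl _ hW)
  let J : V →ₗ[ℝ] V := im ∘ₗ (W.restrictScalars ℝ).subtype ∘ₗ e.symm.toLinearMap
  have hJ : ∀ w ∈ W, J (re w) = im w := by
    intro w hw
    have : e.symm (re w) = ⟨w, hw⟩ := e.symm_apply_eq.2 rfl
    simp [J, this]
  have hsurj : ∀ v, ∃ w ∈ W, re w = v := fun v =>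
    ⟨e.symm v, (e.symm v).2, e.apply_symm_apply v⟩
  refine ⟨J, ⟨?_, le_antisymm ?_ ?_⟩, ?_⟩
  · ext v
    obtain ⟨w, hw, rfl⟩ := hsurj v
    have h := hJ _ (W.smul_mem Complex.I hw)
    rw [re_I_smul, im_I_smul, map_neg] at h
    rw [LinearMap.comp_apply, hJ w hw, neg_eq_iff_eq_neg.1 h]
    rfl
  · intro w hw
    refine Submodule.subset_span ⟨re w, ?_⟩
    simp only [hJ w hw, re_add_im]
  · rw [Submodule.span_le]
    rintro _ ⟨v, rfl⟩
    obtain ⟨w, hw, rfl⟩ := hsurj v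
    simpa only [hJ w hw, re_add_im, SetLike.mem_coe] using hw
  · rintro J' ⟨-, hJ'⟩
    ext v
    have hmem : (1 : ℂ) ⊗ₜ[ℝ] v + Complex.I ⊗ₜ[ℝ] (J' v) ∈ W := by
      rw [hJ']
      exact Submodule.subset_span ⟨v, rfl⟩
    simpa using (hJ _ hmem).symm
end

section
/- Let 𝔤 be a finite-dimensional real Lie algebra and let J : 𝔤 → 𝔤 be an ℝ-linear map with J ∘ J = −id. Then the Nijenhuis tensor N_J vanishes identically (N_J(X,Y) = 0 for all X, Y ∈ 𝔤) if and only if h_J, the ℂ-linear span in the complexification 𝔤_ℂ = 𝔤 ⊗_ℝ ℂ of {v ⊗ 1 + (J v) ⊗ i : v ∈ 𝔤}, is closed under the Lie bracket of 𝔤_ℂ (i.e. is a complex Lie subalgebra of 𝔤_ℂ). -/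
open scoped TensorProduct

/-- On the span of the vectors `1 ⊗ v + I ⊗ J v`, the complexification of `J` acts as `-I`. -/
lemma baseChange_apply_of_mem_span {V : Type*} [AddCommGroup V] [Module ℝ V]
    {J : V →ₗ[ℝ] V} (hJ : J ∘ₗ J = -LinearMap.id) {z : ℂ ⊗[ℝ] V}
    (hz : z ∈ Submodule.span ℂ
      (Set.range fun v : V => (1 : ℂ) ⊗ₜ[ℝ] v + Complex.I ⊗ₜ[ℝ] (J v))) :
    J.baseChange ℂ z = -Complex.I • z := by
  have hJJ (v : V) : J (J v) = -v := LinearMap.congr_fun hJ v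
  induction hz using Submodule.span_induction with
  | mem _ h =>
    obtain ⟨v, rfl⟩ := h
    simp [TensorProduct.smul_tmul', hJJ, TensorProduct.tmul_neg, TensorProduct.neg_tmul, add_comm]
  | zero => simp
  | add _ _ _ _ hx hy => rw [map_add, hx, hy, smul_add]
  | smul c _ _ hx => rw [map_smul, hx, smul_comm]

lemma one_tmul_add_I_tmul_right_inj {V : Type*} [AddCommGroup V] [Module ℝ V] {a b c d : V}
    (h : (1 : ℂ) ⊗ₜ[ℝ] a + Complex.I ⊗ₜ[ℝ] b = (1 : ℂ) ⊗ₜ[ℝ] c + Complex.I ⊗ₜ[ℝ] d) :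
    b = d := by
  simpa using congrArg ((TensorProduct.lid ℝ V).toLinearMap ∘ₗ Complex.imLm.rTensor V) h

lemma lie_one_tmul_add_I_tmul {𝔤 : Type*} [LieRing 𝔤] [LieAlgebra ℝ 𝔤] (a b c d : 𝔤) :
    ⁅(1 : ℂ) ⊗ₜ[ℝ] a + Complex.I ⊗ₜ[ℝ] b, (1 : ℂ) ⊗ₜ[ℝ] c + Complex.I ⊗ₜ[ℝ] d⁆ =
      (1 : ℂ) ⊗ₜ[ℝ] (⁅a, c⁆ - ⁅b, d⁆) + Complex.I ⊗ₜ[ℝ] (⁅a, d⁆ + ⁅b, c⁆) := by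
  simp only [lie_add, add_lie, LieAlgebra.ExtendScalars.bracket_tmul, one_mul, mul_one,
    Complex.I_mul_I, TensorProduct.tmul_sub, TensorProduct.tmul_add, TensorProduct.neg_tmul]
  abel

/-- Let `𝔤` be a finite-dimensional real Lie algebra and `J : 𝔤 → 𝔤` an
`ℝ`-linear map with `J ∘ J = -id`.  Then the Nijenhuis tensor
`N_J(X,Y) = ⁅JX,JY⁆ - J⁅JX,Y⁆ - J⁅X,JY⁆ - ⁅X,Y⁆` vanishes identically if and only if
`h_J`, the `ℂ`-span in `𝔤_ℂ = ℂ ⊗[ℝ] 𝔤` of `{v ⊗ 1 + (J v) ⊗ i : v ∈ 𝔤}`, is closed under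
the Lie bracket of `𝔤_ℂ`. -/
theorem stmt2 (𝔤 : Type) [LieRing 𝔤] [LieAlgebra ℝ 𝔤] [Module.Finite ℝ 𝔤]
    (J : 𝔤 →ₗ[ℝ] 𝔤) (hJ : J ∘ₗ J = -LinearMap.id)
    (hJspan : Submodule ℂ (ℂ ⊗[ℝ] 𝔤))
    (hhJ : hJspan = Submodule.span ℂ
        (Set.range fun v : 𝔤 => (1 : ℂ) ⊗ₜ[ℝ] v + Complex.I ⊗ₜ[ℝ] (J v))) :
    (∀ X Y : 𝔤, ⁅J X, J Y⁆ - J ⁅J X, Y⁆ - J ⁅X, J Y⁆ - ⁅X, Y⁆ = 0) ↔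
      (∀ u v : ℂ ⊗[ℝ] 𝔤, u ∈ hJspan → v ∈ hJspan → ⁅u, v⁆ ∈ hJspan) := by
  subst hhJ
  have hJJ (v : 𝔤) : J (J v) = -v := LinearMap.congr_fun hJ v
  constructor
  · intro hN u v hu hv
    induction hu, hv using Submodule.span_induction₂ with
    | mem_mem _ _ hx hy =>
      obtain ⟨X, rfl⟩ := hx
      obtain ⟨Y, rfl⟩ := hy
      have hB : ⁅X, J Y⁆ + ⁅J X, Y⁆ = J (⁅X, Y⁆ - ⁅J X, J Y⁆) := by
        have hA : ⁅X, Y⁆ - ⁅J X, J Y⁆ = -J (⁅X, J Y⁆ + ⁅J X, Y⁆) := by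
          rw [map_add, ← sub_eq_zero, ← neg_eq_zero, ← hN X Y]
          abel
        rw [hA, map_neg, hJJ, neg_neg]
      rw [lie_one_tmul_add_I_tmul, hB]
      exact Submodule.subset_span ⟨_, rfl⟩
    | zero_left => simp
    | zero_right x _ => rw [show ⁅x, (0 : ℂ ⊗[ℝ] 𝔤)⁆ = 0 from lie_zero x]; exact zero_mem _
    | add_left _ _ _ _ _ _ hx hy => rw [add_lie]; exact add_mem hx hy
    | add_right x y z _ _ _ hx hy => rw [show ⁅x, y + z⁆ = ⁅x, y⁆ + ⁅x, z⁆ from lie_add x y z]; exact add_mem hx hy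
    | smul_left c _ _ _ _ h => rw [smul_lie]; exact Submodule.smul_mem _ c h
    | smul_right c x y _ _ h => rw [show ⁅x, c • y⁆ = c • ⁅x, y⁆ from lie_smul c x y]; exact Submodule.smul_mem _ c h
  · intro h X Y
    have key := baseChange_apply_of_mem_span hJ
      (h _ _ (Submodule.subset_span ⟨X, rfl⟩) (Submodule.subset_span ⟨Y, rfl⟩))
    rw [lie_one_tmul_add_I_tmul, map_add, LinearMap.baseChange_tmul, LinearMap.baseChange_tmul,
      smul_add, TensorProduct.smul_tmul', TensorProduct.smul_tmul', smul_eq_mul, smul_eq_mul,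
      neg_mul, neg_mul, Complex.I_mul_I, neg_neg, mul_one, TensorProduct.neg_tmul,
      ← TensorProduct.tmul_neg, add_comm (Complex.I ⊗ₜ[ℝ] _)] at key
    have hB := one_tmul_add_I_tmul_right_inj key
    rw [map_add, ← sub_eq_zero, ← neg_eq_zero] at hB
    rw [← hB]
    abel
end

section
/- Let G be the set of all 4×4 complex matrices of the form with rows (e^x, 0, 0, y), (0, e^{−x}, 0, z), (0, 0, 1, x), (0, 0, 0, 1) for x, y, z ∈ ℂ. Then G is a subgroup of GL(4, ℂ), and G admits a lattice: there exists a subgroup Γ of G such that Γ, with the topology induced from G (as a subspace of the 4×4 complex matrices), is discrete, and the quotient space G/Γ of left cosets is compact. -/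
open Matrix

namespace SolvLattice

/-- The matrix with rows `(e^x,0,0,y)`, `(0,e^{-x},0,z)`, `(0,0,1,x)`, `(0,0,0,1)`. -/
noncomputable def mat (x y z : ℂ) : Matrix (Fin 4) (Fin 4) ℂ :=
  !![Complex.exp x, 0, 0, y;
     0, Complex.exp (-x), 0, z;
     0, 0, 1, x;
     0, 0, 0, 1]

lemma mat_mul (x y z x' y' z' : ℂ) :
    mat x y z * mat x' y' z' =
      mat (x + x') (y + Complex.exp x * y') (z + Complex.exp (-x) * z') := by
  ext i j
  fin_cases i <;> fin_cases j <;>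
    simp [mat, Matrix.mul_apply, Fin.sum_univ_four, Complex.exp_add, add_comm]

lemma mat_zero : mat 0 0 0 = 1 := by
  ext i j
  fin_cases i <;> fin_cases j <;> simp [mat]

lemma mat_mul_inv (x y z : ℂ) :
    mat x y z * mat (-x) (Complex.exp (-x) * -y) (Complex.exp x * -z) = 1 := by
  rw [mat_mul, ← mat_zero, ← mul_assoc, ← mul_assoc, ← Complex.exp_add, ← Complex.exp_add]
  simp

lemma mat_inv_mul (x y z : ℂ) :
    mat (-x) (Complex.exp (-x) * -y) (Complex.exp x * -z) * mat x y z = 1 := by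
  rw [mat_mul, ← mat_zero]
  simp

/-- The matrix `mat x y z` as an element of `GL(4, ℂ)`. -/
noncomputable def elt (x y z : ℂ) : GL (Fin 4) ℂ where
  val := mat x y z
  inv := mat (-x) (Complex.exp (-x) * -y) (Complex.exp x * -z)
  val_inv := mat_mul_inv x y z
  inv_val := mat_inv_mul x y z

lemma val_inv_of_val_eq {g : GL (Fin 4) ℂ} {x y z : ℂ} (h : g.val = mat x y z) :
    (g⁻¹).val = mat (-x) (Complex.exp (-x) * -y) (Complex.exp x * -z) := by
  obtain rfl : g = elt x y z := Units.ext h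
  rfl

lemma continuous_mat {X : Type*} [TopologicalSpace X] {f g h : X → ℂ} (hf : Continuous f)
    (hg : Continuous g) (hh : Continuous h) : Continuous fun p => mat (f p) (g p) (h p) := by
  refine continuous_matrix fun i j => ?_
  fin_cases i <;> fin_cases j <;> simp [mat] <;> fun_prop

lemma continuous_elt {X : Type*} [TopologicalSpace X] {f g h : X → ℂ} (hf : Continuous f)
    (hg : Continuous g) (hh : Continuous h) : Continuous fun p => elt (f p) (g p) (h p) := by
  rw [Units.continuous_iff]
  exact ⟨continuous_mat hf hg hh,
    continuous_mat (by fun_prop) (by fun_prop) (by fun_prop)⟩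

/-- The solvable group `ℂ² ⋊ ℂ` as a subgroup of `GL(4, ℂ)`. -/
def solvGroup : Subgroup (GL (Fin 4) ℂ) where
  carrier := {g | ∃ x y z : ℂ, g.val = mat x y z}
  mul_mem' := by
    rintro _ _ ⟨x, y, z, h⟩ ⟨x', y', z', h'⟩
    exact ⟨_, _, _, by rw [Units.val_mul, h, h', mat_mul]⟩
  one_mem' := ⟨0, 0, 0, mat_zero.symm⟩
  inv_mem' := by
    rintro _ ⟨x, y, z, h⟩
    exact ⟨_, _, _, val_inv_of_val_eq h⟩

/-- The logarithm of the larger eigenvalue of the integer matrix `(2 1; 1 1)`. -/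
noncomputable def period : ℝ := Real.log ((3 + √5) / 2)

lemma period_pos : 0 < period :=
  Real.log_pos (by linarith [Real.sqrt_nonneg 5])

lemma exp_period : Real.exp period = (3 + √5) / 2 :=
  Real.exp_log (by positivity)

lemma exp_neg_period : Real.exp (-period) = (3 - √5) / 2 := by
  rw [Real.exp_neg, exp_period]
  refine inv_eq_of_mul_eq_one_right ?_
  nlinarith [Real.sq_sqrt (show (0 : ℝ) ≤ 5 by norm_num)]

/-- The larger eigenvalue of `(2 1; 1 1)`. -/
noncomputable def eig : ℂ := Complex.exp period

/-- The smaller eigenvalue of `(2 1; 1 1)`. -/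
noncomputable def eigInv : ℂ := Complex.exp (-period)

lemma eig_mul_eigInv : eig * eigInv = 1 := by
  simp [eig, eigInv, ← Complex.exp_add]

lemma eig_add_eigInv : eig + eigInv = 3 := by
  rw [eig, eigInv, ← Complex.ofReal_neg, ← Complex.ofReal_exp, ← Complex.ofReal_exp,
    exp_period, exp_neg_period]
  push_cast
  ring

lemma eig_sub_eigInv : eig - eigInv = (√5 : ℝ) := by
  rw [eig, eigInv, ← Complex.ofReal_neg, ← Complex.ofReal_exp, ← Complex.ofReal_exp,
    exp_period, exp_neg_period]
  push_cast
  ring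

/-- The lattice of pairs `(a + b λ, a + b λ⁻¹)` in `ℂ²` with `a, b` Gaussian integers. -/
noncomputable def planeLattice : AddSubgroup (ℂ × ℂ) where
  carrier := {p | ∃ a b : GaussianInt,
    p = ((a : ℂ) + b * eig, (a : ℂ) + b * eigInv)}
  add_mem' := by
    rintro _ _ ⟨a, b, rfl⟩ ⟨a', b', rfl⟩
    refine ⟨a + a', b + b', ?_⟩
    ext <;> simp <;> ring
  zero_mem' := ⟨0, 0, by simp [Prod.ext_iff]⟩
  neg_mem' := by
    rintro _ ⟨a, b, rfl⟩
    refine ⟨-a, -b, ?_⟩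
    ext <;> simp <;> ring

lemma eig_mul_mem {p : ℂ × ℂ} (hp : p ∈ planeLattice) :
    (eig * p.1, eigInv * p.2) ∈ planeLattice := by
  obtain ⟨a, b, rfl⟩ := hp
  refine ⟨-b, a + (b + b + b), ?_⟩
  ext
  · simp
    linear_combination (b : ℂ) * eig * eig_add_eigInv - (b : ℂ) * eig_mul_eigInv
  · simp
    linear_combination (b : ℂ) * eigInv * eig_add_eigInv - (b : ℂ) * eig_mul_eigInv

lemma eigInv_mul_mem {p : ℂ × ℂ} (hp : p ∈ planeLattice) :
    (eigInv * p.1, eig * p.2) ∈ planeLattice := by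
  obtain ⟨a, b, rfl⟩ := hp
  refine ⟨a + a + a + b, -a, ?_⟩
  ext
  · simp
    linear_combination (a : ℂ) * eig_add_eigInv + (b : ℂ) * eig_mul_eigInv
  · simp
    linear_combination (a : ℂ) * eig_add_eigInv + (b : ℂ) * eig_mul_eigInv

/-- The element `m t + 2πi n` of the lattice of exponents, where `e^t` is the eigenvalue. -/
noncomputable def expo (m n : ℤ) : ℂ := m * period + n * (2 * Real.pi * Complex.I)

lemma exp_expo (m n : ℤ) : Complex.exp (expo m n) = eig ^ m := by
  rw [expo, Complex.exp_add, Complex.exp_int_mul_two_pi_mul_I, mul_one, Complex.exp_int_mul, eig]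

lemma exp_neg_expo (m n : ℤ) : Complex.exp (-expo m n) = eigInv ^ m := by
  rw [Complex.exp_neg, exp_expo, eigInv, Complex.exp_neg, _root_.inv_zpow, eig]

lemma zpow_mul_mem (m : ℤ) {p : ℂ × ℂ} (hp : p ∈ planeLattice) :
    (eig ^ m * p.1, eigInv ^ m * p.2) ∈ planeLattice := by
  have h₁ : eig ≠ 0 := Complex.exp_ne_zero _
  have h₂ : eigInv ≠ 0 := Complex.exp_ne_zero _
  have h₃ : eig⁻¹ = eigInv := inv_eq_of_mul_eq_one_right eig_mul_eigInv
  have h₄ : eigInv⁻¹ = eig := by rw [← h₃, inv_inv]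
  induction m using Int.induction_on with
  | zero => simpa using hp
  | succ k ih =>
    convert eig_mul_mem ih using 2
    · rw [zpow_add_one₀ h₁]; ring
    · rw [zpow_add_one₀ h₂]; ring
  | pred k ih =>
    convert eigInv_mul_mem ih using 2
    · rw [zpow_sub_one₀ h₁, h₃]; ring
    · rw [zpow_sub_one₀ h₂, h₄]; ring

lemma exp_expo_mul_mem (m n : ℤ) {y z : ℂ} (hp : (y, z) ∈ planeLattice) :
    (Complex.exp (expo m n) * y, Complex.exp (-expo m n) * z) ∈ planeLattice := by
  rw [exp_expo, exp_neg_expo]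
  exact zpow_mul_mem m hp

lemma expo_add (m n m' n' : ℤ) : expo (m + m') (n + n') = expo m n + expo m' n' := by
  simp only [expo]; push_cast; ring

lemma expo_neg (m n : ℤ) : expo (-m) (-n) = -expo m n := by
  simp only [expo]; push_cast; ring

/-- The lattice in `solvGroup`: exponents in `ℤ t + 2πi ℤ`, translations in `planeLattice`. -/
def lattice : Subgroup solvGroup where
  carrier := {g | ∃ m n : ℤ, ∃ y z : ℂ, (y, z) ∈ planeLattice ∧ g.1.val = mat (expo m n) y z}
  mul_mem' := by
    rintro _ _ ⟨m, n, y, z, hp, h⟩ ⟨m', n', y', z', hp', h'⟩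
    refine ⟨m + m', n + n', _, _, add_mem hp (exp_expo_mul_mem m n hp'), ?_⟩
    rw [Subgroup.coe_mul, Units.val_mul, h, h', mat_mul, expo_add]
    rfl
  one_mem' := ⟨0, 0, 0, 0, zero_mem _, by simp [expo, mat_zero]⟩
  inv_mem' := by
    rintro _ ⟨m, n, y, z, hp, h⟩
    have hp' := exp_expo_mul_mem (-m) (-n) (neg_mem hp)
    rw [expo_neg, neg_neg] at hp'
    refine ⟨-m, -n, _, _, hp', ?_⟩
    rw [Subgroup.coe_inv, val_inv_of_val_eq h, expo_neg]
    rfl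

lemma gaussianInt_eq_zero {a : GaussianInt} (h : ‖(a : ℂ)‖ < 1) : a = 0 := by
  have h₁ : ((a.norm : ℤ) : ℝ) < 1 := by
    rw [GaussianInt.intCast_real_norm, Complex.normSq_eq_norm_sq]
    nlinarith [norm_nonneg (a : ℂ)]
  have h₂ : a.norm < 1 := by exact_mod_cast h₁
  exact GaussianInt.norm_eq_zero.1 (by have := GaussianInt.norm_nonneg a; omega)

lemma exists_gaussianInt_near (w : ℂ) : ∃ a : GaussianInt, ‖w - a‖ ≤ 2 := by
  refine ⟨⟨⌊w.re⌋, ⌊w.im⌋⟩, (Complex.norm_le_abs_re_add_abs_im _).trans ?_⟩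
  have h₁ : |w.re - ⌊w.re⌋| ≤ 1 := by
    rw [Int.self_sub_floor, abs_of_nonneg (Int.fract_nonneg _)]
    exact (Int.fract_lt_one _).le
  have h₂ : |w.im - ⌊w.im⌋| ≤ 1 := by
    rw [Int.self_sub_floor, abs_of_nonneg (Int.fract_nonneg _)]
    exact (Int.fract_lt_one _).le
  simpa [GaussianInt.toComplex_def, one_add_one_eq_two] using add_le_add h₁ h₂

lemma planeLattice_eq_zero {y z : ℂ} (hp : (y, z) ∈ planeLattice) (hy : ‖y‖ < 1 / 2)
    (hz : ‖z‖ < 1 / 2) : y = 0 ∧ z = 0 := by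
  obtain ⟨a, b, h⟩ := hp
  obtain ⟨rfl, rfl⟩ := Prod.ext_iff.1 h
  have hb : b = 0 := by
    apply gaussianInt_eq_zero
    have h₁ := norm_sub_le ((a : ℂ) + b * eig) (a + b * eigInv)
    rw [show (a : ℂ) + b * eig - (a + b * eigInv) = b * (eig - eigInv) by ring,
      eig_sub_eigInv, norm_mul, Complex.norm_real, Real.norm_of_nonneg (Real.sqrt_nonneg _)] at h₁
    have h₂ : (1 : ℝ) ≤ √5 := Real.one_le_sqrt.2 (by norm_num)
    simp only at hy hz
    nlinarith [norm_nonneg (b : ℂ)]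
  subst hb
  have ha : a = 0 := gaussianInt_eq_zero (by simp at hy; linarith)
  subst ha
  simp

lemma expo_re (m n : ℤ) : (expo m n).re = m * period := by simp [expo]

lemma expo_im (m n : ℤ) : (expo m n).im = n * (2 * Real.pi) := by simp [expo]

lemma int_eq_zero_of_abs_mul_lt {m : ℤ} {c : ℝ} (hc : 0 < c) (h : |m * c| < c) : m = 0 := by
  rw [abs_mul, abs_of_pos hc] at h
  have : |(m : ℝ)| < 1 := by nlinarith
  exact Int.abs_lt_one_iff.1 (by exact_mod_cast this)

lemma expo_eq_zero {m n : ℤ} (h₁ : ‖expo m n‖ < period) (h₂ : ‖expo m n‖ < 2 * Real.pi) :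
    expo m n = 0 := by
  have hm : m = 0 := int_eq_zero_of_abs_mul_lt period_pos
    (by rw [← expo_re m n]; exact (Complex.abs_re_le_norm _).trans_lt h₁)
  have hn : n = 0 := int_eq_zero_of_abs_mul_lt Real.two_pi_pos
    (by rw [← expo_im m n]; exact (Complex.abs_im_le_norm _).trans_lt h₂)
  simp [hm, hn, expo]

instance discreteTopology_lattice : DiscreteTopology lattice := by
  rw [discreteTopology_iff_isOpen_singleton_one]
  have hc : ∀ i j, Continuous fun g : lattice => ‖g.1.1.val i j‖ := fun i j =>
    ((Units.continuous_val.comp (continuous_subtype_val.comp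
      continuous_subtype_val)).matrix_elem i j).norm
  have ho : IsOpen {g : lattice | ((‖g.1.1.val 2 3‖ < period ∧ ‖g.1.1.val 2 3‖ < 2 * Real.pi) ∧
      ‖g.1.1.val 0 3‖ < 1 / 2) ∧ ‖g.1.1.val 1 3‖ < 1 / 2} :=
    (((isOpen_lt (hc 2 3) continuous_const).inter (isOpen_lt (hc 2 3) continuous_const)).inter
      (isOpen_lt (hc 0 3) continuous_const)).inter (isOpen_lt (hc 1 3) continuous_const)
  convert ho using 1
  ext g
  constructor
  · rintro rfl
    simp [period_pos, Real.pi_pos]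
  · rintro ⟨⟨⟨h₁, h₂⟩, hy⟩, hz⟩
    obtain ⟨m, n, y, z, hp, h⟩ := g.2
    rw [h] at h₁ h₂ hy hz
    have hx := expo_eq_zero (m := m) (n := n) (by simpa [mat] using h₁) (by simpa [mat] using h₂)
    obtain ⟨rfl, rfl⟩ := planeLattice_eq_zero hp (by simpa [mat] using hy) (by simpa [mat] using hz)
    rw [hx, mat_zero] at h
    exact Subtype.ext (Subtype.ext (Units.ext h))

lemma exists_int_near (r : ℝ) {c : ℝ} (hc : 0 < c) : ∃ m : ℤ, |r - m * c| ≤ c := by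
  refine ⟨⌊r / c⌋, ?_⟩
  have h₁ := (le_div_iff₀ hc).1 (Int.floor_le (r / c))
  have h₂ := (div_lt_iff₀ hc).1 (Int.lt_floor_add_one (r / c))
  rw [abs_le]
  constructor <;> linarith

lemma exists_expo_near (x : ℂ) : ∃ m n : ℤ, ‖x - expo m n‖ ≤ period + 2 * Real.pi := by
  obtain ⟨m, hm⟩ := exists_int_near x.re period_pos
  obtain ⟨n, hn⟩ := exists_int_near x.im Real.two_pi_pos
  refine ⟨m, n, (Complex.norm_le_abs_re_add_abs_im _).trans ?_⟩
  rw [Complex.sub_re, Complex.sub_im, expo_re, expo_im]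
  exact add_le_add hm hn

lemma exists_planeLattice_near (p q : ℂ) : ∃ α β y z : ℂ, ‖α‖ ≤ 2 ∧ ‖β‖ ≤ 2 ∧
    (y, z) ∈ planeLattice ∧ p = α + β * eig + y ∧ q = α + β * eigInv + z := by
  have h5 : ((√5 : ℝ) : ℂ) ≠ 0 := by simp
  obtain ⟨b, hb⟩ := exists_gaussianInt_near ((p - q) / (√5 : ℝ))
  obtain ⟨a, ha⟩ := exists_gaussianInt_near (p - (p - q) / (√5 : ℝ) * eig)
  refine ⟨_, _, _, _, ha, hb, ⟨a, b, rfl⟩, by ring, ?_⟩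
  have h : (p - q) / (√5 : ℝ) * (eig - eigInv) = p - q := by
    rw [eig_sub_eigInv, div_mul_cancel₀ _ h5]
  linear_combination h

/-- A parametrization of `solvGroup` in which bounded parameters reach every coset. -/
noncomputable def param (p : ℂ × ℂ × ℂ) : solvGroup :=
  ⟨elt p.1 (Complex.exp p.1 * (p.2.1 + p.2.2 * eig))
    (Complex.exp (-p.1) * (p.2.1 + p.2.2 * eigInv)), _, _, _, rfl⟩

lemma continuous_param : Continuous param :=
  (continuous_elt (by fun_prop) (by fun_prop) (by fun_prop)).subtype_mk _

instance compactSpace_quotient : CompactSpace (solvGroup ⧸ lattice) := by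
  have hK : IsCompact (Metric.closedBall (0 : ℂ) (period + 2 * Real.pi) ×ˢ
      Metric.closedBall (0 : ℂ) 2 ×ˢ Metric.closedBall (0 : ℂ) 2) :=
    (isCompact_closedBall _ _).prod ((isCompact_closedBall _ _).prod (isCompact_closedBall _ _))
  have hc : Continuous fun p => (QuotientGroup.mk (param p) : solvGroup ⧸ lattice) :=
    QuotientGroup.continuous_mk.comp continuous_param
  refine ⟨(hK.image hc).of_isClosed_subset isClosed_univ ?_⟩
  rintro c -
  obtain ⟨g, rfl⟩ := QuotientGroup.mk_surjective c
  obtain ⟨x, y, z, hg⟩ := g.2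
  obtain ⟨m, n, hx⟩ := exists_expo_near x
  set x₁ := x - expo m n with hx₁
  obtain ⟨α, β, y', z', hα, hβ, hp, h₁, h₂⟩ :=
    exists_planeLattice_near (Complex.exp (-x₁) * y) (Complex.exp x₁ * z)
  refine ⟨(x₁, α, β), ⟨by simpa using hx, by simpa using hα, by simpa using hβ⟩, ?_⟩
  refine QuotientGroup.eq.2 ?_
  let γ : solvGroup := ⟨elt (expo m n) y' z', _, _, _, rfl⟩
  have hγ : γ ∈ lattice := ⟨m, n, y', z', hp, rfl⟩
  have key : g = param (x₁, α, β) * γ := by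
    refine Subtype.ext (Units.ext ?_)
    rw [hg]
    change _ = mat _ _ _ * mat _ _ _
    rw [mat_mul, ← mul_add, ← mul_add, ← h₁, ← h₂, ← mul_assoc, ← mul_assoc, ← Complex.exp_add,
      ← Complex.exp_add]
    simp [hx₁]
  rw [key, inv_mul_cancel_left]
  exact hγ

end SolvLattice

/-- The set of matrices with rows `(e^x,0,0,y)`, `(0,e^{-x},0,z)`,
`(0,0,1,x)`, `(0,0,0,1)` for `x, y, z ∈ ℂ` is a subgroup `G` of `GL(4, ℂ)` (the
three-dimensional simply connected complex solvable Lie group of non-nilpotent type), and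
`G` admits a lattice: a discrete subgroup `Γ` with compact quotient `G/Γ` of left cosets. -/
theorem stmt5 :
    ∃ G : Subgroup (GL (Fin 4) ℂ),
      (∀ g : GL (Fin 4) ℂ, g ∈ G ↔
        ∃ x y z : ℂ, (g : Matrix (Fin 4) (Fin 4) ℂ) =
          !![Complex.exp x, 0, 0, y;
             0, Complex.exp (-x), 0, z;
             0, 0, 1, x;
             0, 0, 0, 1]) ∧
      ∃ Γ : Subgroup G, DiscreteTopology Γ ∧ CompactSpace (G ⧸ Γ) := by
  exact ⟨SolvLattice.solvGroup, fun _ => Iff.rfl, SolvLattice.lattice, inferInstance, inferInstance⟩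
end

section
/- Let A be the integer 4×4 matrix with rows (0,1,0,0), (0,0,1,0), (0,0,0,1), (−1,1,−3,1). Then det A = 1 (so A ∈ SL(4,ℤ)), the characteristic polynomial of A is t⁴ − t³ + 3t² − t + 1, this polynomial has no real roots, and whenever γ ∈ ℂ is a root of it, γ⁻¹ is also a root; consequently A has four pairwise distinct non-real eigenvalues of the form γ, γ⁻¹, γ̄, γ̄⁻¹. -/
open Matrix Polynomial

/-- The reciprocal quartic `t⁴ - t³ + 3t² - t + 1` is positive on `ℝ`. -/
lemma quartic_pos (t : ℝ) : 0 < t ^ 4 - t ^ 3 + 3 * t ^ 2 - t + 1 := by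
  nlinarith [sq_nonneg (t ^ 2 - t / 2), sq_nonneg (t - 1 / 2), sq_nonneg t]

lemma quartic_inv {z : ℂ} (hz : z ^ 4 - z ^ 3 + 3 * z ^ 2 - z + 1 = 0) :
    z⁻¹ ^ 4 - z⁻¹ ^ 3 + 3 * z⁻¹ ^ 2 - z⁻¹ + 1 = 0 := by
  have hz0 : z ≠ 0 := by
    rintro rfl
    norm_num at hz
  field_simp
  linear_combination hz

lemma quartic_conj {z : ℂ} (hz : z ^ 4 - z ^ 3 + 3 * z ^ 2 - z + 1 = 0) :
    (starRingEnd ℂ) z ^ 4 - (starRingEnd ℂ) z ^ 3 + 3 * (starRingEnd ℂ) z ^ 2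
      - (starRingEnd ℂ) z + 1 = 0 := by
  simpa [map_ofNat] using congrArg (starRingEnd ℂ) hz

lemma quartic_conj_ne {z : ℂ} (hz : z ^ 4 - z ^ 3 + 3 * z ^ 2 - z + 1 = 0) :
    (starRingEnd ℂ) z ≠ z := by
  intro h
  obtain ⟨x, rfl⟩ := Complex.conj_eq_iff_real.mp h
  exact (quartic_pos x).ne' (by exact_mod_cast hz)

/-- A root of the quartic is not on the unit circle: otherwise the real number `s = z + z⁻¹`
would satisfy `s² - s + 1 = 0`. -/
lemma quartic_mul_conj_ne_one {z : ℂ} (hz : z ^ 4 - z ^ 3 + 3 * z ^ 2 - z + 1 = 0) :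
    z * (starRingEnd ℂ) z ≠ 1 := by
  intro h
  have hz0 : z ≠ 0 := left_ne_zero_of_mul_eq_one h
  have hs : z + (starRingEnd ℂ) z = ((2 * z.re : ℝ) : ℂ) := Complex.add_conj z
  set s : ℝ := 2 * z.re
  have hq : z ^ 2 * ((s : ℂ) ^ 2 - s + 1) = 0 := by
    rw [← hs]
    linear_combination hz + (z * (starRingEnd ℂ) z + 1 + 2 * z ^ 2 - z) * h
  have hreal : s ^ 2 - s + 1 = 0 := by
    exact_mod_cast (mul_eq_zero.mp hq).resolve_left (pow_ne_zero 2 hz0)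
  nlinarith [sq_nonneg (s - 1 / 2)]

/-- The integer matrix `A` with rows `(0,1,0,0)`, `(0,0,1,0)`, `(0,0,0,1)`,
`(-1,1,-3,1)` lies in `SL(4,ℤ)`, its characteristic polynomial is
`t⁴ - t³ + 3t² - t + 1`, this polynomial has no real roots, its set of complex roots is
closed under inversion, and `A` has four pairwise distinct non-real eigenvalues of the form
`γ, γ⁻¹, γ̄, γ̄⁻¹`. -/
theorem stmt7 (A : Matrix (Fin 4) (Fin 4) ℤ)
    (hA : A = !![0, 1, 0, 0; 0, 0, 1, 0; 0, 0, 0, 1; -1, 1, -3, 1]) :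
    A.det = 1 ∧
    A.charpoly = X ^ 4 - X ^ 3 + 3 * X ^ 2 - X + 1 ∧
    (∀ t : ℝ, ¬ (A.charpoly.map (Int.castRingHom ℝ)).IsRoot t) ∧
    (∀ γ : ℂ, (A.charpoly.map (Int.castRingHom ℂ)).IsRoot γ →
      (A.charpoly.map (Int.castRingHom ℂ)).IsRoot γ⁻¹) ∧
    ∃ γ : ℂ, γ.im ≠ 0 ∧
      [γ, γ⁻¹, (starRingEnd ℂ) γ, ((starRingEnd ℂ) γ)⁻¹].Pairwise (· ≠ ·) ∧
      (A.charpoly.map (Int.castRingHom ℂ)).roots =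
        {γ, γ⁻¹, (starRingEnd ℂ) γ, ((starRingEnd ℂ) γ)⁻¹} := by
  have hchar : A.charpoly = X ^ 4 - X ^ 3 + 3 * X ^ 2 - X + 1 := by
    subst hA
    simp [Matrix.charpoly, Matrix.charmatrix, Matrix.det_succ_row_zero, Fin.sum_univ_succ,
      Fin.succAbove, Matrix.submatrix, Matrix.diagonal]
    ring
  have hdet : A.det = 1 := by
    subst hA
    decide
  have hroot : ∀ z : ℂ, (A.charpoly.map (Int.castRingHom ℂ)).IsRoot z ↔
      z ^ 4 - z ^ 3 + 3 * z ^ 2 - z + 1 = 0 := by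
    intro z
    simp [hchar, IsRoot.def]
  have hmonic : (A.charpoly.map (Int.castRingHom ℂ)).Monic := A.charpoly_monic.map _
  have hdeg : (A.charpoly.map (Int.castRingHom ℂ)).natDegree = 4 := by
    rw [A.charpoly_monic.natDegree_map, A.charpoly_natDegree_eq_dim, Fintype.card_fin]
  refine ⟨hdet, hchar, fun t ht => ?_, fun γ hγ => ?_, ?_⟩
  · exact (quartic_pos t).ne' (by simpa [hchar, IsRoot.def] using ht)
  · exact (hroot _).mpr (quartic_inv ((hroot _).mp hγ))
  · obtain ⟨γ, hγ⟩ := IsAlgClosed.exists_root (A.charpoly.map (Int.castRingHom ℂ))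
      (by rw [degree_eq_natDegree hmonic.ne_zero, hdeg]; norm_num)
    rw [hroot] at hγ
    have hγ0 : γ ≠ 0 := by
      rintro rfl
      norm_num at hγ
    have hconj := quartic_conj hγ
    have hconj0 : (starRingEnd ℂ) γ ≠ 0 := by simpa using hγ0
    have hne := quartic_conj_ne hγ
    have hmul := quartic_mul_conj_ne_one hγ
    have hself : ∀ z : ℂ, z ^ 4 - z ^ 3 + 3 * z ^ 2 - z + 1 = 0 → z ≠ z⁻¹ := by
      intro z hz h
      rcases self_eq_inv₀.mp h with rfl | rfl | rfl <;> norm_num at hz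
    have hpair : [γ, γ⁻¹, (starRingEnd ℂ) γ, ((starRingEnd ℂ) γ)⁻¹].Pairwise (· ≠ ·) := by
      have h14 : γ ≠ ((starRingEnd ℂ) γ)⁻¹ := fun h => hmul ((eq_mul_inv_iff_mul_eq₀ hconj0).mp (h.trans (one_mul _).symm))
      have h23 : γ⁻¹ ≠ (starRingEnd ℂ) γ := fun h => h14 (by rw [← h, inv_inv])
      have h24 : γ⁻¹ ≠ ((starRingEnd ℂ) γ)⁻¹ := fun h => hne (inv_injective h).symm
      simp only [List.pairwise_cons, List.mem_cons, List.not_mem_nil, or_false, forall_eq_or_imp,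
        forall_eq, false_imp_iff, implies_true, List.Pairwise.nil, and_true]
      exact ⟨⟨hself _ hγ, hne.symm, h14⟩, ⟨h23, h24⟩, hself _ hconj⟩
    refine ⟨γ, fun h => hne (Complex.conj_eq_iff_im.mpr h), hpair, ?_⟩
    symm
    refine Multiset.eq_of_le_of_card_le ((Multiset.le_iff_subset ?_).mpr fun z hz => ?_) ?_
    · exact Multiset.coe_nodup.mpr hpair
    · rw [mem_roots hmonic.ne_zero, hroot]
      simp only [Multiset.insert_eq_cons, Multiset.mem_cons, Multiset.mem_singleton] at hz
      rcases hz with rfl | rfl | rfl | rfl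
      exacts [hγ, quartic_inv hγ, hconj, quartic_inv hconj]
    · exact (card_roots' _).trans hdeg.le
end

section
/- Let A be a 2×2 real matrix, let γ ∈ ℝ with γ ≠ 1 and γ ≠ −1, and suppose (a₁,a₂) ∈ ℝ² and (b₁,b₂) ∈ ℝ² are nonzero vectors with A·(a₁,a₂) = γ·(a₁,a₂) and A·(b₁,b₂) = γ⁻¹·(b₁,b₂). Let ε ∈ ℂ be non-real. Then the four vectors (a₁,b₁), (a₂,b₂), (εa₁,εb₁), (εa₂,εb₂) in ℂ² are linearly independent over ℝ. -/
open Matrix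

/-- Eigenvectors of a real 2×2 matrix for distinct eigenvalues have nonzero determinant. -/
theorem det_ne_zero_of_mulVec_eq_smul {A : Matrix (Fin 2) (Fin 2) ℝ} {μ ν : ℝ} (hμν : μ ≠ ν)
    {a b : Fin 2 → ℝ} (ha : a ≠ 0) (hb : b ≠ 0)
    (haA : A.mulVec a = μ • a) (hbA : A.mulVec b = ν • b) :
    a 0 * b 1 - a 1 * b 0 ≠ 0 := by
  intro hD
  have ha' (k : Fin 2) : A k 0 * a 0 + A k 1 * a 1 = μ * a k := by
    simpa [Matrix.mulVec, dotProduct] using congrFun haA k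
  have hb' (k : Fin 2) : A k 0 * b 0 + A k 1 * b 1 = ν * b k := by
    simpa [Matrix.mulVec, dotProduct] using congrFun hbA k
  have hcomm (i j : Fin 2) : a i * b j = a j * b i := by
    fin_cases i <;> fin_cases j <;> simp <;> linarith
  obtain ⟨j, hj⟩ := Function.ne_iff.mp ha
  obtain ⟨k, hk⟩ := Function.ne_iff.mp hb
  have hprod : (μ - ν) * (a j * b k) = 0 := by
    linear_combination (-b j) * ha' k + a j * hb' k + μ * hcomm j k
      + A k 0 * hcomm 0 j + A k 1 * hcomm 1 j
  exact mul_ne_zero (sub_ne_zero.mpr hμν) (mul_ne_zero hj hk) hprod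

/-- A 2×2 homogeneous linear system with nonzero determinant has only the zero solution. -/
theorem eq_zero_of_det_ne_zero {a b : Fin 2 → ℝ} (hD : a 0 * b 1 - a 1 * b 0 ≠ 0) {x y : ℝ}
    (h₁ : x * a 0 + y * a 1 = 0) (h₂ : x * b 0 + y * b 1 = 0) : x = 0 ∧ y = 0 :=
  ⟨(mul_eq_zero.mp (by linear_combination b 1 * h₁ - a 1 * h₂ :
      (a 0 * b 1 - a 1 * b 0) * x = 0)).resolve_left hD,
    (mul_eq_zero.mp (by linear_combination a 0 * h₂ - b 0 * h₁ :
      (a 0 * b 1 - a 1 * b 0) * y = 0)).resolve_left hD⟩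

/-- Let `A` be a real 2×2 matrix, `γ ∈ ℝ` with `γ ≠ 0, ±1` (so that `γ⁻¹` is
meaningful as an eigenvalue), and let `(a₁,a₂)`, `(b₁,b₂)` be nonzero real eigenvectors of
`A` for the eigenvalues `γ` and `γ⁻¹` respectively.  Then for any non-real `ε ∈ ℂ`, the four
vectors `(a₁,b₁)`, `(a₂,b₂)`, `(εa₁,εb₁)`, `(εa₂,εb₂)` of `ℂ²` are linearly independent
over `ℝ`. -/
theorem stmt8 (A : Matrix (Fin 2) (Fin 2) ℝ) (γ : ℝ)
    (hγ0 : γ ≠ 0) (hγ1 : γ ≠ 1) (hγ2 : γ ≠ -1)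
    (a b : Fin 2 → ℝ) (ha : a ≠ 0) (hb : b ≠ 0)
    (haA : A.mulVec a = γ • a) (hbA : A.mulVec b = γ⁻¹ • b)
    (ε : ℂ) (hε : ε.im ≠ 0) :
    LinearIndependent ℝ
      ![(![(a 0 : ℂ), (b 0 : ℂ)] : Fin 2 → ℂ),
        ![(a 1 : ℂ), (b 1 : ℂ)],
        ![ε * a 0, ε * b 0],
        ![ε * a 1, ε * b 1]] := by
  have hγ : γ ≠ γ⁻¹ := by
    intro h
    have hsq : γ * γ = 1 := by
      nth_rewrite 2 [h]
      exact mul_inv_cancel₀ hγ0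
    exact (mul_self_eq_one_iff.mp hsq).elim hγ1 hγ2
  have hD := det_ne_zero_of_mulVec_eq_smul hγ ha hb haA hbA
  rw [Fintype.linearIndependent_iff]
  intro g hg
  have h0 := congrFun hg 0
  have h1 := congrFun hg 1
  simp [Fin.sum_univ_four, Complex.ext_iff] at h0 h1
  obtain ⟨h0re, h0im⟩ := h0
  obtain ⟨h1re, h1im⟩ := h1
  obtain ⟨h2, h3⟩ := eq_zero_of_det_ne_zero hD (x := g 2) (y := g 3)
    ((mul_eq_zero.mp (by linear_combination h0im :
      ε.im * (g 2 * a 0 + g 3 * a 1) = 0)).resolve_left hε)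
    ((mul_eq_zero.mp (by linear_combination h1im :
      ε.im * (g 2 * b 0 + g 3 * b 1) = 0)).resolve_left hε)
  rw [h2, h3] at h0re h1re
  obtain ⟨h4, h5⟩ := eq_zero_of_det_ne_zero hD (x := g 0) (y := g 1)
    (by linear_combination h0re) (by linear_combination h1re)
  intro i
  fin_cases i <;> assumption
end

section
/- Let A be a 2×2 real matrix, let λ ∈ ℂ be non-real, and let v = (α₁, α₂) ∈ ℂ² be a nonzero vector with A·v = λ·v (where A acts on ℂ² via its entries regarded as complex numbers). Then the complex numbers α₁ and α₂ are linearly independent over ℝ (in ℂ regarded as a real vector space). -/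
open Matrix

/-- Let `A` be a real 2×2 matrix, `λ ∈ ℂ` non-real, and `v = (α₁,α₂) ∈ ℂ²` a
nonzero vector with `A·v = λ·v` (entries of `A` coerced into `ℂ`).  Then `α₁` and `α₂` are
linearly independent over `ℝ` in `ℂ` regarded as a real vector space. -/
theorem stmt9 (A : Matrix (Fin 2) (Fin 2) ℝ) (lam : ℂ) (hlam : lam.im ≠ 0)
    (v : Fin 2 → ℂ) (hv : v ≠ 0)
    (hAv : (A.map (Complex.ofReal)).mulVec v = lam • v) :
    LinearIndependent ℝ ![v 0, v 1] := by
  have h0 := congrFun hAv 0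
  have h1 := congrFun hAv 1
  simp only [Matrix.mulVec, dotProduct, Fin.sum_univ_two, Matrix.map_apply, Pi.smul_apply,
    smul_eq_mul] at h0 h1
  have real_mul : ∀ (r : ℝ) (z : ℂ), (r : ℂ) * z = lam * z → z = 0 := by
    intro r z h
    by_contra hz
    have hr : (r : ℂ) = lam := mul_right_cancel₀ hz h
    exact hlam (by rw [← hr, Complex.ofReal_im])
  have hne : ¬ (v 0 = 0 ∧ v 1 = 0) := by
    rintro ⟨ha, hb⟩
    exact hv (funext fun i => by fin_cases i <;> simpa)
  rw [LinearIndependent.pair_iff]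
  intro s t hst
  simp only [Complex.real_smul] at hst
  have ht : t = 0 := by
    by_contra ht
    have htc : (t : ℂ) ≠ 0 := Complex.ofReal_ne_zero.mpr ht
    have hv1 : v 1 = -(s / t) * v 0 := by
      field_simp
      linear_combination hst
    have hv0 : v 0 = 0 := by
      apply real_mul (A 0 0 - A 0 1 * (s / t))
      push_cast
      linear_combination h0 - (A 0 1 : ℂ) * hv1
    exact hne ⟨hv0, by rw [hv1, hv0, mul_zero]⟩
  refine ⟨?_, ht⟩
  by_contra hs
  have hv0 : v 0 = 0 := by
    simpa [ht, hs] using hst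
  refine hne ⟨hv0, real_mul (A 1 1) (v 1) ?_⟩
  simpa [hv0] using h1
end

section
/- Let P be an invertible 4×4 real matrix, let α, β, γ, δ ∈ ℂ, let A be the complex 2×2 matrix (α β; γ δ), let D = diag(−1,−1,1,1), and let M be the complex 4×4 block matrix (αI₂ βI₂; γI₂ δI₂) (the Kronecker product of A with the 2×2 identity). If D·P = P·M, where P is regarded as a complex matrix by coercing its entries, then α, β, γ, δ are all real and there exists an invertible 2×2 real matrix K with K⁻¹·A·K = diag(−1, 1) (as complex matrices). -/
open Matrix

/-- If a real matrix `P` is invertible and `D * P = P * M` with `D` real, then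
`M` is real and the identity already holds over `ℝ`. -/
theorem Matrix.real_of_map_ofReal_mul_eq {n : Type*} [Fintype n] [DecidableEq n]
    {P D : Matrix n n ℝ} (hP : IsUnit P) {M : Matrix n n ℂ}
    (h : D.map Complex.ofReal * P.map Complex.ofReal = P.map Complex.ofReal * M) :
    M.map Complex.im = 0 ∧ D * P = P * M.map Complex.re := by
  have entry (i j : n) := congrFun (congrFun h i) j
  simp only [mul_apply, map_apply] at entry
  constructor
  · apply hP.mul_left_cancel
    ext i j
    have := congrArg Complex.im (entry i j)
    simpa [mul_apply] using this.symm
  · ext i j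
    have := congrArg Complex.re (entry i j)
    simpa [mul_apply] using this

/-- A real traceless `2 × 2` matrix of determinant `-1` is conjugate to `diag(-1, 1)`. -/
theorem Matrix.exists_isUnit_mul_eq_mul_diag {a b c : ℝ} (h : a * a + b * c = 1) :
    ∃ K : Matrix (Fin 2) (Fin 2) ℝ, IsUnit K ∧
      !![a, b; c, -a] * K = K * !![-1, 0; 0, 1] := by
  by_cases ha : a = 1
  · subst ha
    refine ⟨!![b, 2; -2, c], ?_, ?_⟩
    · rw [isUnit_iff_isUnit_det, det_fin_two_of, isUnit_iff_ne_zero]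
      intro h0
      linarith
    · ext i j
      fin_cases i <;> fin_cases j <;> simp <;> grind
  · refine ⟨!![a - 1, b; c, 1 - a], ?_, ?_⟩
    · rw [isUnit_iff_isUnit_det, det_fin_two_of, isUnit_iff_ne_zero]
      intro h0
      exact ha (by linarith)
    · ext i j
      fin_cases i <;> fin_cases j <;> simp <;> linarith

/-- Let `P` be an invertible real 4×4 matrix, `α, β, γ, δ ∈ ℂ`,
`A = (α β; γ δ)`, `D = diag(-1,-1,1,1)` and `M = (αI₂ βI₂; γI₂ δI₂)`.  If `D·P = P·M`
(with `P` coerced to a complex matrix), then `α, β, γ, δ` are real and there is an invertible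
real 2×2 matrix `K` with `K⁻¹·A·K = diag(-1,1)` as complex matrices. -/
theorem stmt10 (P : Matrix (Fin 4) (Fin 4) ℝ) (hP : IsUnit P)
    (α β γ δ : ℂ)
    (h : (Matrix.diagonal ![(-1 : ℂ), -1, 1, 1]) * P.map Complex.ofReal =
      P.map Complex.ofReal *
        !![α, 0, β, 0; 0, α, 0, β; γ, 0, δ, 0; 0, γ, 0, δ]) :
    α.im = 0 ∧ β.im = 0 ∧ γ.im = 0 ∧ δ.im = 0 ∧
    ∃ K : Matrix (Fin 2) (Fin 2) ℝ, IsUnit K ∧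
      (K.map Complex.ofReal)⁻¹ * !![α, β; γ, δ] * K.map Complex.ofReal =
        !![(-1 : ℂ), 0; 0, 1] := by
  set D : Matrix (Fin 4) (Fin 4) ℝ := diagonal ![-1, -1, 1, 1] with hD
  have hDmap : diagonal ![(-1 : ℂ), -1, 1, 1] = D.map Complex.ofReal := by
    ext i j
    fin_cases i <;> fin_cases j <;> simp [hD]
  rw [hDmap] at h
  obtain ⟨him, hre⟩ := real_of_map_ofReal_mul_eq hP h
  set N := (!![α, 0, β, 0; 0, α, 0, β; γ, 0, δ, 0; 0, γ, 0, δ] : Matrix _ _ ℂ).map Complex.re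
    with hN
  have hα : α.im = 0 := by simpa using congrFun (congrFun him 0) 0
  have hβ : β.im = 0 := by simpa using congrFun (congrFun him 0) 2
  have hγ : γ.im = 0 := by simpa using congrFun (congrFun him 2) 0
  have hδ : δ.im = 0 := by simpa using congrFun (congrFun him 2) 2
  refine ⟨hα, hβ, hγ, hδ, ?_⟩
  have hDD : D * D = 1 := by
    ext i j
    fin_cases i <;> fin_cases j <;> simp [hD]
  have hNN : N * N = 1 := by
    apply hP.mul_left_cancel
    rw [← mul_assoc, ← hre, mul_assoc, ← hre, ← mul_assoc, hDD, one_mul, mul_one]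
  have hPdet : IsUnit P.det := (isUnit_iff_isUnit_det P).1 hP
  have htrace : N.trace = D.trace := by
    rw [← nonsing_inv_mul_cancel_left P N hPdet, ← hre, trace_mul_comm,
      mul_nonsing_inv_cancel_right P D hPdet]
  have hδα : δ.re = -α.re := by
    simp [trace, Fin.sum_univ_four, hN, hD] at htrace
    linarith
  have hsq : α.re * α.re + β.re * γ.re = 1 := by
    simpa [hN, mul_apply, Fin.sum_univ_four] using congrFun (congrFun hNN 0) 0
  obtain ⟨K, hK, hconj⟩ := exists_isUnit_mul_eq_mul_diag hsq
  refine ⟨K, hK, ?_⟩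
  have hKdet : IsUnit (K.map Complex.ofReal).det :=
    (isUnit_iff_isUnit_det _).1 (hK.map Complex.ofRealHom.mapMatrix)
  have hA : !![α, β; γ, δ] = (!![α.re, β.re; γ.re, -α.re]).map Complex.ofReal := by
    ext i j
    fin_cases i <;> fin_cases j <;> simp [Complex.ext_iff, *]
  have hdiag : !![(-1 : ℂ), 0; 0, 1] = (!![(-1 : ℝ), 0; 0, 1]).map Complex.ofReal := by
    ext i j
    fin_cases i <;> fin_cases j <;> simp
  have hconjC := congrArg Complex.ofRealHom.mapMatrix hconj
  simp only [map_mul] at hconjC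
  rw [mul_assoc, hA, hdiag]
  exact (congrArg _ hconjC).trans (nonsing_inv_mul_cancel_left _ _ hKdet)
end

section
/- Define ω : ℂ³ × ℂ³ → ℝ by ω(u, v) = −2·Im(u₁·conj(v₁)) + 2·Re(u₂·conj(v₃) − v₂·conj(u₃)), where u = (u₁,u₂,u₃), v = (v₁,v₂,v₃). Then: (a) ω is ℝ-bilinear and alternating; (b) ω is nondegenerate, i.e. if ω(u, v) = 0 for all v ∈ ℂ³ then u = 0; (c) ω is invariant under multiplication by i: ω(i·u, i·v) = ω(u, v) for all u, v; and (d) for every λ ∈ ℂ whose imaginary part is an integer multiple of π, the ℂ-linear map D_λ : ℂ³ → ℂ³ given by D_λ(u₁,u₂,u₃) = (u₁, e^λ u₂, e^{−λ} u₃) satisfies ω(D_λ u, D_λ v) = ω(u, v) for all u, v ∈ ℂ³. -/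
open Complex

theorem exp_mul_conj_exp_neg_eq_one {z : ℂ} (hz : ∃ k : ℤ, z.im = k * Real.pi) :
    exp z * (starRingEnd ℂ) (exp (-z)) = 1 := by
  obtain ⟨k, hk⟩ := hz
  rw [← exp_conj, ← exp_add, exp_eq_one_iff]
  refine ⟨k, ?_⟩
  rw [map_neg, ← sub_eq_add_neg, sub_conj, hk]
  push_cast
  ring

/-- The coordinate expression
`ω(u,v) = -2·Im(u₁·conj v₁) + 2·Re(u₂·conj v₃ - v₂·conj u₃)` of the pseudo-Kähler form
`ω = i dx∧dx̄ + dy∧dz̄ + dȳ∧dz` on `ℂ³` is (a) `ℝ`-bilinear and alternating,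
(b) nondegenerate, (c) invariant under multiplication by `i`, and (d) invariant under the
maps `D_λ(u₁,u₂,u₃) = (u₁, e^λ u₂, e^{-λ} u₃)` whenever `Im λ ∈ πℤ`. -/
theorem stmt14 (ω : (Fin 3 → ℂ) → (Fin 3 → ℂ) → ℝ)
    (hω : ω = fun u v =>
      -2 * (u 0 * (starRingEnd ℂ) (v 0)).im +
        2 * (u 1 * (starRingEnd ℂ) (v 2) - v 1 * (starRingEnd ℂ) (u 2)).re) :
    -- (a) ℝ-bilinear and alternating
    ((∀ u u' v : Fin 3 → ℂ, ω (u + u') v = ω u v + ω u' v) ∧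
     (∀ (c : ℝ) (u v : Fin 3 → ℂ), ω (c • u) v = c * ω u v) ∧
     (∀ u v v' : Fin 3 → ℂ, ω u (v + v') = ω u v + ω u v') ∧
     (∀ (c : ℝ) (u v : Fin 3 → ℂ), ω u (c • v) = c * ω u v) ∧
     (∀ u : Fin 3 → ℂ, ω u u = 0)) ∧
    -- (b) nondegenerate
    (∀ u : Fin 3 → ℂ, (∀ v : Fin 3 → ℂ, ω u v = 0) → u = 0) ∧
    -- (c) invariant under multiplication by i
    (∀ u v : Fin 3 → ℂ, ω (Complex.I • u) (Complex.I • v) = ω u v) ∧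
    -- (d) invariant under D_λ for Im λ ∈ π ℤ
    (∀ lam : ℂ, (∃ k : ℤ, lam.im = k * Real.pi) →
      ∀ u v : Fin 3 → ℂ,
        ω (![u 0, Complex.exp lam * u 1, Complex.exp (-lam) * u 2])
          (![v 0, Complex.exp lam * v 1, Complex.exp (-lam) * v 2]) = ω u v) := by
  subst hω
  refine ⟨⟨?_, ?_, ?_, ?_, ?_⟩, ?_, ?_, ?_⟩
  · intro u u' v
    simp
    ring
  · intro c u v
    simp
    ring
  · intro u v v'
    simp
    ring
  · intro c u v
    simp
    ring
  · intro u
    simp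
    ring
  · intro u h
    have key := h ![I * u 0, -u 2, u 1]
    simp at key
    have h0 : u 0 = 0 := by
      apply Complex.ext <;> simp <;> nlinarith [sq_nonneg (u 0).re, sq_nonneg (u 0).im,
        sq_nonneg (u 1).re, sq_nonneg (u 1).im, sq_nonneg (u 2).re, sq_nonneg (u 2).im]
    have h1 : u 1 = 0 := by
      apply Complex.ext <;> simp <;> nlinarith [sq_nonneg (u 0).re, sq_nonneg (u 0).im,
        sq_nonneg (u 1).re, sq_nonneg (u 1).im, sq_nonneg (u 2).re, sq_nonneg (u 2).im]
    have h2 : u 2 = 0 := by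
      apply Complex.ext <;> simp <;> nlinarith [sq_nonneg (u 0).re, sq_nonneg (u 0).im,
        sq_nonneg (u 1).re, sq_nonneg (u 1).im, sq_nonneg (u 2).re, sq_nonneg (u 2).im]
    ext i
    fin_cases i <;> simp [h0, h1, h2]
  · intro u v
    simp
    ring
  · rintro lam hlam u v
    have hE := exp_mul_conj_exp_neg_eq_one hlam
    have hz : exp lam * u 1 * (starRingEnd ℂ) (exp (-lam) * v 2) -
        exp lam * v 1 * (starRingEnd ℂ) (exp (-lam) * u 2) =
        u 1 * (starRingEnd ℂ) (v 2) - v 1 * (starRingEnd ℂ) (u 2) := by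
      simp only [map_mul]
      linear_combination (u 1 * (starRingEnd ℂ) (v 2) - v 1 * (starRingEnd ℂ) (u 2)) * hE
    exact congrArg (fun z : ℂ => -2 * (u 0 * (starRingEnd ℂ) (v 0)).im + 2 * z.re) hz
end
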